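/- Let A, B, C, D, E, F, G, H be eight distinct points of ℙ²(ℂ) on an irreducible conic 𝒞, and let 𝒬₁, 𝒬₂, 𝒬₃ be three quartics through all eight points such that each of the three pairs (𝒬₂,𝒬₃), (𝒬₁,𝒬₃), (𝒬₁,𝒬₂) has defining polynomials with no common nonconstant factor and common zero set consisting of exactly sixteen distinct points (the eight given points and eight residual points). Let 𝒞₁, 𝒞₂, 𝒞₃ be mystic conics of the pairs (𝒬₂,𝒬₃), (𝒬₁,𝒬₃), (𝒬₁,𝒬₂) respectively, that is, conics passing through the corresponding eight residual intersection points, and assume that for each pair the conic through its eight residual points is unique up to a scalar. Then the defining degree-2 polynomials of 𝒞₁, 𝒞₂ and 𝒞₃ are linearly dependent over ℂ, i.e. the three conics belong to one pencil of conics. -/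

import Mathlib

open MvPolynomial

noncomputable section

/-- Polynomials in three variables over `ℂ`. -/
abbrev Poly3 : Type := MvPolynomial (Fin 3) ℂ

/-- The complex projective plane `ℙ²(ℂ)`, the projectivization of `ℂ³`. -/
abbrev ProjPlane : Type := Projectivization ℂ (Fin 3 → ℂ)

/-- A (homogeneous) polynomial vanishes at a projective point if it vanishes at its
canonical nonzero representative vector (for homogeneous polynomials this is equivalent
to vanishing at any nonzero representative vector). -/
def VanishesAt (F : Poly3) (p : ProjPlane) : Prop :=
  MvPolynomial.eval p.rep F = 0

/-- The set of points of `ℙ²(ℂ)` at which `F` vanishes. -/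
def zeroSet (F : Poly3) : Set ProjPlane := {p | VanishesAt F p}

/-- Two defining polynomials give the same curve iff they are proportional by a
nonzero scalar. -/
def ProportionalTo (F G : Poly3) : Prop := ∃ c : ℂ, c ≠ 0 ∧ G = c • F

/-- A set of points is collinear if some nonzero homogeneous polynomial of degree 1
vanishes at all of them. -/
def Collin (s : Set ProjPlane) : Prop :=
  ∃ L : Poly3, L ≠ 0 ∧ L.IsHomogeneous 1 ∧ ∀ p ∈ s, VanishesAt L p

/-- No three distinct points of `s` are collinear. -/
def NoThreeCollinear (s : Set ProjPlane) : Prop :=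
  ∀ p q r, p ∈ s → q ∈ s → r ∈ s → p ≠ q → p ≠ r → q ≠ r → ¬ Collin {p, q, r}

/-- `L` is a (the) line through the points `p` and `q`. -/
def IsLineThrough (L : Poly3) (p q : ProjPlane) : Prop :=
  L ≠ 0 ∧ L.IsHomogeneous 1 ∧ VanishesAt L p ∧ VanishesAt L q

/-- `L` is the generalized Pascal line of the cubics `D₁` and `D₂` with respect to six
points `A, …, F`: the cubics have no common nonconstant factor, their common zero set
consists of exactly nine distinct points (the six given ones plus three further points),
and `L` is the line through the three further intersection points. -/
def IsGenPascalLine (A B C D E F : ProjPlane) (D₁ D₂ L : Poly3) : Prop :=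
  IsRelPrime D₁ D₂ ∧ L ≠ 0 ∧ L.IsHomogeneous 1 ∧
    ∃ P Q R : ProjPlane,
      ([A, B, C, D, E, F, P, Q, R] : List ProjPlane).Pairwise (· ≠ ·) ∧
      zeroSet D₁ ∩ zeroSet D₂ = {A, B, C, D, E, F, P, Q, R} ∧
      VanishesAt L P ∧ VanishesAt L Q ∧ VanishesAt L R

/-- The exponents of a monomial of a homogeneous polynomial of degree `n` add up to `n`. -/
lemma sum_eq_of_mem_support {F : Poly3} {n : ℕ} (hF : F.IsHomogeneous n) {d : Fin 3 →₀ ℕ}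
    (hd : d ∈ F.support) : ∑ i, d i = n := by
  rw [hF.degree_eq_sum_deg_support hd]
  exact (Finset.sum_subset (Finset.subset_univ _)
    fun i _ hi => Finsupp.notMem_support_iff.1 hi).symm

/-- A homogeneous polynomial of degree `n` scales by `c ^ n` under scaling by `c`. -/
lemma eval_smul_of_isHomogeneous {F : Poly3} {n : ℕ} (hF : F.IsHomogeneous n) (c : ℂ)
    (v : Fin 3 → ℂ) : eval (c • v) F = c ^ n * eval v F := by
  rw [eval_eq', eval_eq', Finset.mul_sum]
  refine Finset.sum_congr rfl fun d hd => ?_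
  simp only [Pi.smul_apply, smul_eq_mul, mul_pow, Finset.prod_mul_distrib,
    Finset.prod_pow_eq_pow_sum]
  rw [sum_eq_of_mem_support hF hd]
  ring

/-- The evaluation of a homogeneous polynomial of degree two is a ternary quadratic form. -/
lemma exists_eval_eq_quadraticForm {F : Poly3} (hF : F.IsHomogeneous 2) :
    ∃ k₁ k₂ k₃ k₄ k₅ k₆ : ℂ, ∀ v, eval v F = k₁ * v 0 ^ 2 + k₂ * v 1 ^ 2 + k₃ * v 2 ^ 2
      + k₄ * (v 0 * v 1) + k₅ * (v 0 * v 2) + k₆ * (v 1 * v 2) := by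
  have hmon : ∀ d ∈ F.support, ∃ k₁ k₂ k₃ k₄ k₅ k₆ : ℂ, ∀ v : Fin 3 → ℂ,
      coeff d F * ∏ i, v i ^ d i = k₁ * v 0 ^ 2 + k₂ * v 1 ^ 2 + k₃ * v 2 ^ 2
      + k₄ * (v 0 * v 1) + k₅ * (v 0 * v 2) + k₆ * (v 1 * v 2) := by
    intro d hd
    have h := sum_eq_of_mem_support hF hd
    rw [Fin.sum_univ_three] at h
    simp only [Fin.prod_univ_three]
    set k := coeff d F
    obtain h | h | h | h | h | h : (d 0 = 2 ∧ d 1 = 0 ∧ d 2 = 0) ∨ (d 0 = 0 ∧ d 1 = 2 ∧ d 2 = 0) ∨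
        (d 0 = 0 ∧ d 1 = 0 ∧ d 2 = 2) ∨ (d 0 = 1 ∧ d 1 = 1 ∧ d 2 = 0) ∨
        (d 0 = 1 ∧ d 1 = 0 ∧ d 2 = 1) ∨ (d 0 = 0 ∧ d 1 = 1 ∧ d 2 = 1) := by omega
    · exact ⟨k, 0, 0, 0, 0, 0, fun v => by simp [h]⟩
    · exact ⟨0, k, 0, 0, 0, 0, fun v => by simp [h]⟩
    · exact ⟨0, 0, k, 0, 0, 0, fun v => by simp [h]⟩
    · exact ⟨0, 0, 0, k, 0, 0, fun v => by simp [h]⟩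
    · exact ⟨0, 0, 0, 0, k, 0, fun v => by simp [h]⟩
    · exact ⟨0, 0, 0, 0, 0, k, fun v => by simp [h]⟩
  choose! k₁ k₂ k₃ k₄ k₅ k₆ h using hmon
  refine ⟨∑ d ∈ F.support, k₁ d, ∑ d ∈ F.support, k₂ d, ∑ d ∈ F.support, k₃ d,
    ∑ d ∈ F.support, k₄ d, ∑ d ∈ F.support, k₅ d, ∑ d ∈ F.support, k₆ d, fun v => ?_⟩
  rw [eval_eq']
  simp only [Finset.sum_mul, ← Finset.sum_add_distrib]
  exact Finset.sum_congr rfl fun d hd => h d hd v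

/-- A polynomial which is a product of two linear functionals is not irreducible. -/
lemma not_irreducible_of_eval_eq_mul {F : Poly3} (f g : Module.Dual ℂ (Fin 3 → ℂ))
    (h : ∀ v, eval v F = f v * g v) : ¬ Irreducible F := by
  let toPoly (f : Module.Dual ℂ (Fin 3 → ℂ)) : Poly3 := ∑ i, C (f (Pi.single i 1)) * X i
  have hev : ∀ (f : Module.Dual ℂ (Fin 3 → ℂ)) v, eval v (toPoly f) = f v := by
    intro f v
    conv_rhs => rw [LinearMap.pi_apply_eq_sum_univ f v]
    simp only [toPoly, map_sum, map_mul, eval_C, eval_X, smul_eq_mul, mul_comm]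
    refine Finset.sum_congr rfl fun i _ => ?_
    congr 2
    ext j
    simp [Pi.single_apply, eq_comm]
  have hunit : ∀ f, ¬ IsUnit (toPoly f) := by
    intro f hu
    have := hu.map (eval (0 : Fin 3 → ℂ))
    rw [hev, map_zero] at this
    exact not_isUnit_zero this
  intro hF
  have hprod : F = toPoly f * toPoly g :=
    MvPolynomial.funext fun v => by rw [h, map_mul, hev, hev]
  rcases hF.isUnit_or_isUnit hprod with hu | hu
  · exact hunit f hu
  · exact hunit g hu

/-- A nonzero vector of `ℂ³` is part of a basis: every vector decomposes along it and two
further vectors. -/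
lemma exists_decomposition {a : Fin 3 → ℂ} (ha : a ≠ 0) :
    ∃ (n m : Fin 3 → ℂ) (x y z : Module.Dual ℂ (Fin 3 → ℂ)),
      ∀ w, w = x w • a + y w • n + z w • m := by
  obtain ⟨i, hi⟩ := Function.ne_iff.mp ha
  have key : ∀ i j k : Fin 3, a i ≠ 0 → (∀ l, l = i ∨ l = j ∨ l = k) → i ≠ j → i ≠ k → j ≠ k →
      ∃ (n m : Fin 3 → ℂ) (x y z : Module.Dual ℂ (Fin 3 → ℂ)),
      ∀ w, w = x w • a + y w • n + z w • m := by
    intro i j k hi hl hij hik hjk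
    refine ⟨Pi.single j 1, Pi.single k 1, (a i)⁻¹ • LinearMap.proj i,
      LinearMap.proj j - (a j * (a i)⁻¹) • LinearMap.proj i,
      LinearMap.proj k - (a k * (a i)⁻¹) • LinearMap.proj i, fun w => ?_⟩
    ext l
    rcases hl l with rfl | rfl | rfl
    · simp [hij, hik]
      field_simp
    · simp [hjk]
      field_simp
      ring
    · simp [hjk.symm]
      field_simp
      ring
  fin_cases i
  · exact key 0 1 2 hi (by decide) (by decide) (by decide) (by decide)
  · exact key 1 0 2 hi (by decide) (by decide) (by decide) (by decide)
  · exact key 2 0 1 hi (by decide) (by decide) (by decide) (by decide)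

/-- A binary quadratic form over `ℂ` is a product of two linear forms. -/
lemma exists_binary_factorization (α β γ : ℂ) :
    ∃ p q r s : ℂ, ∀ y z : ℂ,
      α * y ^ 2 + β * (y * z) + γ * z ^ 2 = (p * y + q * z) * (r * y + s * z) := by
  by_cases hα : α = 0
  · exact ⟨0, 1, β, γ, fun y z => by rw [hα]; ring⟩
  obtain ⟨t, ht⟩ := IsAlgClosed.exists_eq_mul_self (β ^ 2 - 4 * α * γ)
  refine ⟨α, (β - t) / 2, 1, (β + t) / (2 * α), fun y z => ?_⟩
  field_simp
  linear_combination (-z ^ 2) * ht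

/-- Rational parametrization of the cone over an irreducible conic, by projection from a
point `a` of the conic. -/
lemma exists_conic_parametrization {K : Poly3} (hK : K.IsHomogeneous 2) (hirr : Irreducible K)
    {a : Fin 3 → ℂ} (ha : a ≠ 0) (haK : eval a K = 0) :
    ∃ (c : ℂ) (q r : Fin 3 → ℂ), ∀ w, eval w K = 0 →
      (∃ μ : ℂ, w = μ • a) ∨ ∃ μ s : ℂ, w = μ • (s ^ 2 • c • a + s • q + r) := by
  obtain ⟨n, m, x, y, z, hw⟩ := exists_decomposition ha
  have hexp : ∀ n m : Fin 3 → ℂ, ∃ ln lm kn km b : ℂ, ∀ x y z : ℂ,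
      eval (x • a + y • n + z • m) K =
        x * (y * ln + z * lm) + y ^ 2 * kn + z ^ 2 * km + y * z * b := by
    obtain ⟨k₁, k₂, k₃, k₄, k₅, k₆, hk⟩ := exists_eval_eq_quadraticForm hK
    intro n m
    have polar : ∀ u v : Fin 3 → ℂ, ∃ b : ℂ, b = 2 * k₁ * u 0 * v 0 + 2 * k₂ * u 1 * v 1
      + 2 * k₃ * u 2 * v 2 + k₄ * (u 0 * v 1 + u 1 * v 0) + k₅ * (u 0 * v 2 + u 2 * v 0)
      + k₆ * (u 1 * v 2 + u 2 * v 1) := fun u v => ⟨_, rfl⟩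
    obtain ⟨ln, hln⟩ := polar a n
    obtain ⟨lm, hlm⟩ := polar a m
    obtain ⟨b, hb⟩ := polar n m
    refine ⟨ln, lm, eval n K, eval m K, b, fun x y z => ?_⟩
    rw [hk] at haK
    rw [hk, hk, hk, hln, hlm, hb]
    simp only [Pi.add_apply, Pi.smul_apply, smul_eq_mul]
    linear_combination x ^ 2 * haK
  -- The case of a basis adapted to the tangent line at `a`.
  have main : ∀ (n m : Fin 3 → ℂ) (x y z : Module.Dual ℂ (Fin 3 → ℂ)),
      (∀ w, w = x w • a + y w • n + z w • m) → ∀ kn km b : ℂ,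
      (∀ x y z : ℂ, eval (x • a + y • n + z • m) K =
        x * z + y ^ 2 * kn + z ^ 2 * km + y * z * b) →
      ∃ (c : ℂ) (q r : Fin 3 → ℂ), ∀ w, eval w K = 0 →
      (∃ μ : ℂ, w = μ • a) ∨ ∃ μ s : ℂ, w = μ • (s ^ 2 • c • a + s • q + r) := by
    intro n m x y z hw kn km b hk
    have hkn : kn ≠ 0 := by
      rintro rfl
      refine not_irreducible_of_eval_eq_mul z (x + km • z + b • y) (fun v => ?_) hirr
      conv_lhs => rw [hw v, hk]
      simp only [LinearMap.add_apply, LinearMap.smul_apply, smul_eq_mul]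
      ring
    refine ⟨-kn, n - b • a, m - km • a, fun w h0 => ?_⟩
    rw [hw w, hk] at h0
    by_cases hz : z w = 0
    · left
      have hy : y w = 0 := by simpa [hz, hkn] using h0
      exact ⟨x w, by conv_lhs => rw [hw w, hy, hz]; simp⟩
    · right
      refine ⟨z w, y w / z w, ?_⟩
      have hx : x w = z w * (-(kn * (y w / z w) ^ 2) - b * (y w / z w) - km) := by
        field_simp
        linear_combination h0
      conv_lhs => rw [hw w, hx]
      ext i
      simp only [Pi.add_apply, Pi.smul_apply, Pi.sub_apply, smul_eq_mul]
      field_simp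
      ring
  have main' : ∀ (n m : Fin 3 → ℂ) (x y z : Module.Dual ℂ (Fin 3 → ℂ)),
      (∀ w, w = x w • a + y w • n + z w • m) → ∀ ln lm kn km b : ℂ, lm ≠ 0 →
      (∀ x y z : ℂ, eval (x • a + y • n + z • m) K =
        x * (y * ln + z * lm) + y ^ 2 * kn + z ^ 2 * km + y * z * b) →
      ∃ (c : ℂ) (q r : Fin 3 → ℂ), ∀ w, eval w K = 0 →
      (∃ μ : ℂ, w = μ • a) ∨ ∃ μ s : ℂ, w = μ • (s ^ 2 • c • a + s • q + r) := by
    intro n m x y z hw ln lm kn km b hlm hk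
    refine main (n - (ln / lm) • m) (lm⁻¹ • m) x y (ln • y + lm • z) (fun w => ?_)
      (kn + (ln / lm) ^ 2 * km - (ln / lm) * b) (km / lm ^ 2) (b / lm - 2 * km * ln / lm ^ 2)
      fun x y z => ?_
    · conv_lhs => rw [hw w]
      ext i
      simp only [Pi.add_apply, Pi.smul_apply, Pi.sub_apply, smul_eq_mul, LinearMap.add_apply,
        LinearMap.smul_apply]
      field_simp
      ring
    · rw [show x • a + y • (n - (ln / lm) • m) + z • lm⁻¹ • m
        = x • a + y • n + ((z - y * ln) / lm) • m by
          ext i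
          simp only [Pi.add_apply, Pi.smul_apply, Pi.sub_apply, smul_eq_mul]
          field_simp
          ring, hk]
      field_simp
      ring
  obtain ⟨ln, lm, kn, km, b, hk⟩ := hexp n m
  by_cases hlm : lm = 0
  · by_cases hln : ln = 0
    · obtain ⟨p, q, r, s, hf⟩ := exists_binary_factorization kn b km
      refine absurd hirr (not_irreducible_of_eval_eq_mul (p • y + q • z) (r • y + s • z)
        fun v => ?_)
      conv_lhs => rw [hw v, hk, hln, hlm]
      simp only [LinearMap.add_apply, LinearMap.smul_apply, smul_eq_mul]
      rw [← hf]
      ring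
    · refine main' m n x z y (fun w => ?_) lm ln km kn b hln fun x y z => ?_
      · conv_lhs => rw [hw w]
        abel
      · rw [add_right_comm, hk]
        ring
  · exact main' n m x y z hw ln lm kn km b hlm hk

/-- A polynomial vanishing on the cone defined by an irreducible polynomial is divisible by it. -/
lemma dvd_of_forall_eval_eq_zero {K Q : Poly3} (hirr : Irreducible K)
    (h : ∀ w, eval w K = 0 → eval w Q = 0) : K ∣ Q := by
  have : (Ideal.span {K}).IsPrime := (Ideal.span_singleton_prime hirr.ne_zero).2 hirr.prime
  rw [← Ideal.mem_span_singleton, ← IsPrime.vanishingIdeal_zeroLocus (K := ℂ) (Ideal.span {K}),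
    mem_vanishingIdeal_iff]
  intro w hw
  exact h w (hw K (Ideal.mem_span_singleton_self K))

/-- The cofactor of a homogeneous polynomial in a homogeneous polynomial can be taken
homogeneous. -/
lemma exists_isHomogeneous_cofactor {F G : Poly3} {m n : ℕ} (hF : F.IsHomogeneous m)
    (hG : G.IsHomogeneous (m + n)) (h : F ∣ G) : ∃ H : Poly3, H.IsHomogeneous n ∧ G = F * H := by
  obtain ⟨H, rfl⟩ := h
  refine ⟨homogeneousComponent n H, homogeneousComponent_isHomogeneous n H, ?_⟩
  have hc : ∀ i, homogeneousComponent (m + n) (F * homogeneousComponent i H)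
      = if i = n then F * homogeneousComponent i H else 0 := by
    intro i
    rw [homogeneousComponent_of_mem (hF.mul (homogeneousComponent_isHomogeneous i H))]
    simp [eq_comm]
  conv_lhs => rw [← homogeneousComponent_eq_self hG, ← sum_homogeneousComponent H, Finset.mul_sum,
    map_sum]
  rw [Finset.sum_congr rfl fun i _ => hc i, Finset.sum_ite_eq']
  split_ifs with hn
  · rfl
  · rw [homogeneousComponent_eq_zero _ _ (by simpa using hn), mul_zero]

/-- Restriction of ternary polynomials to the parametrized curve `s ↦ s² p + s q + r`. -/
def restrictToCurve (p q r : Fin 3 → ℂ) : Poly3 →ₐ[ℂ] Polynomial ℂ :=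
  aeval fun i => Polynomial.C (p i) * Polynomial.X ^ 2 + Polynomial.C (q i) * Polynomial.X
    + Polynomial.C (r i)

/-- Evaluating the restriction to the curve is evaluating at the corresponding point. -/
lemma eval_restrictToCurve (p q r : Fin 3 → ℂ) (s : ℂ) (Q : Poly3) :
    (restrictToCurve p q r Q).eval s = eval (s ^ 2 • p + s • q + r) Q := by
  have : ((Polynomial.aeval s).comp (restrictToCurve p q r)) Q
      = aeval (s ^ 2 • p + s • q + r) Q := by
    congr 1
    ext i
    simp [restrictToCurve, mul_comm (s ^ 2), mul_comm s]
  exact this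

lemma natDegree_restrictToCurve_le (p q r : Fin 3 → ℂ) {Q : Poly3} {n : ℕ}
    (hQ : Q.IsHomogeneous n) : (restrictToCurve p q r Q).natDegree ≤ 2 * n := by
  rw [restrictToCurve, aeval_def, eval₂_eq']
  refine Polynomial.natDegree_sum_le_of_forall_le _ _ fun d hd => ?_
  have h := sum_eq_of_mem_support hQ hd
  rw [Fin.sum_univ_three] at h
  rw [Fin.prod_univ_three, ← h]
  have hdeg : ∀ i, (Polynomial.C (p i) * Polynomial.X ^ 2 + Polynomial.C (q i) * Polynomial.X
      + Polynomial.C (r i)).natDegree ≤ 2 := fun i => Polynomial.natDegree_quadratic_le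
  refine (Polynomial.natDegree_C_mul_le _ _).trans ?_
  have hp : ∀ i, _ := fun i => Polynomial.natDegree_pow_le_of_le (d i) (hdeg i)
  exact (Polynomial.natDegree_mul_le_of_le (Polynomial.natDegree_mul_le_of_le (hp 0) (hp 1))
    (hp 2)).trans (by omega)

lemma coeff_restrictToCurve (p q r : Fin 3 → ℂ) {Q : Poly3} {n : ℕ}
    (hQ : Q.IsHomogeneous n) : (restrictToCurve p q r Q).coeff (2 * n) = eval p Q := by
  rw [restrictToCurve, aeval_def, eval₂_eq', Polynomial.finsetSum_coeff, eval_eq']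
  refine Finset.sum_congr rfl fun d hd => ?_
  have h := sum_eq_of_mem_support hQ hd
  rw [Fin.sum_univ_three] at h
  rw [Fin.prod_univ_three, Fin.prod_univ_three, ← h,
    show 2 * (d 0 + d 1 + d 2) = (d 0 * 2 + d 1 * 2) + d 2 * 2 by ring]
  have hdeg : ∀ i, (Polynomial.C (p i) * Polynomial.X ^ 2 + Polynomial.C (q i) * Polynomial.X
      + Polynomial.C (r i)).natDegree ≤ 2 := fun i => Polynomial.natDegree_quadratic_le
  have hp : ∀ i, _ := fun i => Polynomial.natDegree_pow_le_of_le (d i) (hdeg i)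
  rw [Polynomial.algebraMap_eq, Polynomial.coeff_C_mul, Polynomial.coeff_mul_add_eq_of_natDegree_le
    (Polynomial.natDegree_mul_le_of_le (hp 0) (hp 1)) (hp 2),
    Polynomial.coeff_mul_add_eq_of_natDegree_le (hp 0) (hp 1),
    Polynomial.coeff_pow_of_natDegree_le (hdeg 0), Polynomial.coeff_pow_of_natDegree_le (hdeg 1),
    Polynomial.coeff_pow_of_natDegree_le (hdeg 2)]
  simp

/-- The quartics through eight points of an irreducible conic, restricted to the conic, form
a one-dimensional space. -/
lemma exists_linear_functional_on_quartics {K : Poly3} (hK : K.IsHomogeneous 2)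
    (hirr : Irreducible K) {P : Fin 8 → ProjPlane} (hP : Function.Injective P)
    (hPK : ∀ i, VanishesAt K (P i)) :
    ∃ c : Poly3 →ₗ[ℂ] ℂ, ∀ Q : Poly3, Q.IsHomogeneous 4 → (∀ i, VanishesAt Q (P i)) →
      (c Q = 0 → K ∣ Q) ∧
      ∀ R : ProjPlane, R ∉ Set.range P → VanishesAt K R → VanishesAt Q R → K ∣ Q := by
  obtain ⟨c, q, r, hpar⟩ := exists_conic_parametrization hK hirr (P 0).rep_nonzero (hPK 0)
  set a := (P 0).rep
  set ρ := restrictToCurve (c • a) q r with hρ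
  have hpt : ∀ R : ProjPlane, VanishesAt K R → R ≠ P 0 →
      ∃ μ s : ℂ, R.rep = μ • (s ^ 2 • c • a + s • q + r) := by
    intro R hR hne
    refine (hpar _ hR).resolve_left ?_
    rintro ⟨μ, hμ⟩
    refine hne ?_
    rw [← R.mk_rep, ← (P 0).mk_rep, Projectivization.mk_eq_mk_iff']
    exact ⟨μ, hμ.symm⟩
  have hinj : ∀ (R S : ProjPlane) (μ ν s : ℂ), R.rep = μ • (s ^ 2 • c • a + s • q + r) →
      S.rep = ν • (s ^ 2 • c • a + s • q + r) → R = S := by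
    intro R S μ ν s hR hS
    have hν : ν ≠ 0 := by
      rintro rfl
      exact S.rep_nonzero (by rw [hS, zero_smul])
    rw [← R.mk_rep, ← S.mk_rep, Projectivization.mk_eq_mk_iff']
    exact ⟨μ / ν, by rw [hR, hS, smul_smul, div_mul_cancel₀ _ hν]⟩
  have hroot : ∀ Q : Poly3, Q.IsHomogeneous 4 → ∀ (R : ProjPlane) (μ s : ℂ),
      R.rep = μ • (s ^ 2 • c • a + s • q + r) → VanishesAt Q R → (ρ Q).eval s = 0 := by
    intro Q hQ R μ s hR h0
    have hμ : μ ≠ 0 := by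
      rintro rfl
      exact R.rep_nonzero (by rw [hR, zero_smul])
    rw [VanishesAt, hR, eval_smul_of_isHomogeneous hQ] at h0
    rw [hρ, eval_restrictToCurve]
    exact (mul_eq_zero.1 h0).resolve_left (pow_ne_zero _ hμ)
  have hdvd : ∀ Q : Poly3, Q.IsHomogeneous 4 → VanishesAt Q (P 0) → ρ Q = 0 → K ∣ Q := by
    intro Q hQ h0 hzero
    refine dvd_of_forall_eval_eq_zero hirr fun w hw => ?_
    obtain ⟨μ, rfl⟩ | ⟨μ, s, rfl⟩ := hpar w hw
    · rw [eval_smul_of_isHomogeneous hQ, show eval a Q = 0 from h0, mul_zero]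
    · rw [eval_smul_of_isHomogeneous hQ, ← eval_restrictToCurve, ← hρ, hzero,
        Polynomial.eval_zero, mul_zero]
  have hdeg : ∀ Q : Poly3, Q.IsHomogeneous 4 → VanishesAt Q (P 0) → (ρ Q).natDegree < 8 := by
    intro Q hQ h0
    by_contra! hlt
    have hle : (ρ Q).natDegree ≤ 8 := natDegree_restrictToCurve_le _ _ _ hQ
    have hlead : (ρ Q).coeff 8 = 0 := by
      have := coeff_restrictToCurve (c • a) q r hQ
      rwa [eval_smul_of_isHomogeneous hQ, show eval a Q = 0 from h0, mul_zero] at this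
    have h8 : (ρ Q).natDegree = 8 := le_antisymm hle hlt
    rw [← h8, Polynomial.coeff_natDegree, Polynomial.leadingCoeff_eq_zero] at hlead
    simp [hlead] at h8
  choose μ s hs using fun i : Fin 7 =>
    hpt (P i.succ) (hPK _) fun h => Fin.succ_ne_zero i (hP h)
  have hsinj : Function.Injective s := by
    intro i j hij
    have := hinj _ _ _ _ _ (hs i) (hij ▸ hs j)
    exact Fin.succ_injective _ (hP this)
  refine ⟨Polynomial.lcoeff ℂ 7 ∘ₗ ρ.toLinearMap, fun Q hQ hQP => ⟨fun hc => ?_, ?_⟩⟩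
  · refine hdvd Q hQ (hQP 0) (Polynomial.eq_zero_of_natDegree_lt_card_of_eval_eq_zero _ hsinj
      (fun i => hroot Q hQ _ _ _ (hs i) (hQP _)) ?_)
    rw [Fintype.card_fin]
    by_contra! hlt
    have h7 : (ρ Q).natDegree = 7 := by have := hdeg Q hQ (hQP 0); omega
    have hlead : (ρ Q).coeff 7 = 0 := hc
    rw [← h7, Polynomial.coeff_natDegree, Polynomial.leadingCoeff_eq_zero] at hlead
    simp [hlead] at h7
  · intro R hR hKR hQR
    obtain ⟨ν, t, ht⟩ := hpt R hKR fun h => hR ⟨0, h.symm⟩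
    refine hdvd Q hQ (hQP 0) (Polynomial.eq_zero_of_natDegree_lt_card_of_eval_eq_zero _
      (f := (Fin.cons t s : Fin 8 → ℂ)) ?_ ?_ ?_)
    · refine Fin.cons_injective_iff.2 ⟨?_, hsinj⟩
      rintro ⟨i, rfl⟩
      exact hR ⟨_, hinj _ _ _ _ _ (hs i) ht⟩
    · refine Fin.cases ?_ fun i => ?_
      · exact hroot Q hQ _ _ _ ht hQR
      · exact hroot Q hQ _ _ _ (hs i) (hQP _)
    · simpa using hdeg Q hQ (hQP 0)

/-- The mystic conic of a pair of quartics, multiplied by the given conic, is a combination of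
the two quartics. -/
lemma exists_combination_eq_mul_mystic_conic {K : Poly3} (hK : K.IsHomogeneous 2)
    (hirr : Irreducible K) {P : Fin 8 → ProjPlane} {c : Poly3 →ₗ[ℂ] ℂ}
    (hc : ∀ Q : Poly3, Q.IsHomogeneous 4 → (∀ i, VanishesAt Q (P i)) →
      (c Q = 0 → K ∣ Q) ∧
      ∀ R : ProjPlane, R ∉ Set.range P → VanishesAt K R → VanishesAt Q R → K ∣ Q)
    {Q Q' : Poly3} (hQ : Q.IsHomogeneous 4) (hQ' : Q'.IsHomogeneous 4)
    (hQP : ∀ i, VanishesAt Q (P i)) (hQP' : ∀ i, VanishesAt Q' (P i))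
    (hrel : IsRelPrime Q Q') {r : Fin 8 → ProjPlane} (hr : ∀ i, r i ∉ Set.range P)
    (hQr : ∀ i, VanishesAt Q (r i)) (hQr' : ∀ i, VanishesAt Q' (r i)) {M : Poly3}
    (hM : ∀ C' : Poly3, C' ≠ 0 → C'.IsHomogeneous 2 →
      (∀ i, VanishesAt C' (r i)) → ∃ t : ℂ, C' = t • M) :
    (c Q ≠ 0 ∨ c Q' ≠ 0) ∧ ∃ t : ℂ, t ≠ 0 ∧ c Q • Q' - c Q' • Q = K * (t • M) := by
  have hne : c Q ≠ 0 ∨ c Q' ≠ 0 := by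
    by_contra! h
    exact hirr.not_isUnit (hrel ((hc Q hQ hQP).1 h.1) ((hc Q' hQ' hQP').1 h.2))
  refine ⟨hne, ?_⟩
  have hnu : ∀ {F : Poly3}, F.IsHomogeneous 4 → ¬ IsUnit F := by
    intro F hF hu
    have := hu.map (eval (0 : Fin 3 → ℂ))
    rw [← zero_smul ℂ (0 : Fin 3 → ℂ), eval_smul_of_isHomogeneous hF] at this
    simp at this
  have hhom : (c Q • Q' - c Q' • Q).IsHomogeneous (2 + 2) :=
    IsHomogeneous.sub ((homogeneousSubmodule _ _ 4).smul_mem _ hQ')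
      ((homogeneousSubmodule _ _ 4).smul_mem _ hQ)
  have hvan : ∀ p, VanishesAt Q p → VanishesAt Q' p → VanishesAt (c Q • Q' - c Q' • Q) p := by
    intro p h h'
    unfold VanishesAt at *
    simp [smul_eval, h, h']
  have hdvd : K ∣ c Q • Q' - c Q' • Q :=
    (hc _ hhom fun i => hvan _ (hQP i) (hQP' i)).1 (by simp [mul_comm])
  obtain ⟨N, hN, hKN⟩ := exists_isHomogeneous_cofactor hK hhom hdvd
  have hN0 : N ≠ 0 := by
    rintro rfl
    rw [mul_zero, sub_eq_zero] at hKN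
    rcases hne with h | h
    · refine hnu hQ (hrel dvd_rfl ⟨C ((c Q)⁻¹ * c Q'), ?_⟩)
      rw [mul_comm, ← smul_eq_C_mul, mul_smul, ← hKN, smul_smul, inv_mul_cancel₀ h, one_smul]
    · refine hnu hQ' (hrel ⟨C ((c Q')⁻¹ * c Q), ?_⟩ dvd_rfl)
      rw [mul_comm, ← smul_eq_C_mul, mul_smul, hKN, smul_smul, inv_mul_cancel₀ h, one_smul]
  have hNr : ∀ i, VanishesAt N (r i) := by
    intro i
    have h0 := hvan _ (hQr i) (hQr' i)
    rw [hKN, VanishesAt, map_mul, mul_eq_zero] at h0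
    refine h0.resolve_left fun h => hirr.not_isUnit ?_
    exact hrel ((hc Q hQ hQP).2 _ (hr i) h (hQr i)) ((hc Q' hQ' hQP').2 _ (hr i) h (hQr' i))
  obtain ⟨t, rfl⟩ := hM N hN0 hN hNr
  exact ⟨t, fun ht => hN0 (by rw [ht, zero_smul]), hKN⟩

/-- If `𝒬₁`, `𝒬₂`, `𝒬₃` are three quartics through eight distinct points on an
irreducible conic, each pair meeting in exactly sixteen distinct points, and `𝒞₁`,
`𝒞₂`, `𝒞₃` are the mystic conics through the eight residual intersection points of
the pairs `(𝒬₂,𝒬₃)`, `(𝒬₁,𝒬₃)`, `(𝒬₁,𝒬₂)` (each unique up to a scalar), then the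
three conics belong to one pencil: their defining polynomials are linearly dependent. -/
theorem mystic_conics_in_pencil (A B C D E F G H : ProjPlane)
    (hdist : ([A, B, C, D, E, F, G, H] : List ProjPlane).Pairwise (· ≠ ·))
    (K : Poly3) (hKh : K.IsHomogeneous 2) (hKirr : Irreducible K)
    (honK : ∀ p ∈ [A, B, C, D, E, F, G, H], VanishesAt K p)
    (Q₁ Q₂ Q₃ : Poly3)
    (hQ : ∀ Qi ∈ [Q₁, Q₂, Q₃], Qi ≠ 0 ∧ Qi.IsHomogeneous 4 ∧
      ∀ p ∈ [A, B, C, D, E, F, G, H], VanishesAt Qi p)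
    (r₁ r₂ r₃ : Fin 8 → ProjPlane)
    (hr₁ : Function.Injective r₁) (hr₂ : Function.Injective r₂)
    (hr₃ : Function.Injective r₃)
    (hd₁ : ∀ i, r₁ i ∉ ({A, B, C, D, E, F, G, H} : Set ProjPlane))
    (hd₂ : ∀ i, r₂ i ∉ ({A, B, C, D, E, F, G, H} : Set ProjPlane))
    (hd₃ : ∀ i, r₃ i ∉ ({A, B, C, D, E, F, G, H} : Set ProjPlane))
    (hrel₁ : IsRelPrime Q₂ Q₃) (hrel₂ : IsRelPrime Q₁ Q₃) (hrel₃ : IsRelPrime Q₁ Q₂)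
    (hz₁ : zeroSet Q₂ ∩ zeroSet Q₃ = {A, B, C, D, E, F, G, H} ∪ Set.range r₁)
    (hz₂ : zeroSet Q₁ ∩ zeroSet Q₃ = {A, B, C, D, E, F, G, H} ∪ Set.range r₂)
    (hz₃ : zeroSet Q₁ ∩ zeroSet Q₂ = {A, B, C, D, E, F, G, H} ∪ Set.range r₃)
    (C₁ C₂ C₃ : Poly3)
    (hC₁ : C₁ ≠ 0 ∧ C₁.IsHomogeneous 2 ∧ ∀ i, VanishesAt C₁ (r₁ i))
    (hC₂ : C₂ ≠ 0 ∧ C₂.IsHomogeneous 2 ∧ ∀ i, VanishesAt C₂ (r₂ i))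
    (hC₃ : C₃ ≠ 0 ∧ C₃.IsHomogeneous 2 ∧ ∀ i, VanishesAt C₃ (r₃ i))
    (hU₁ : ∀ C' : Poly3, C' ≠ 0 → C'.IsHomogeneous 2 →
      (∀ i, VanishesAt C' (r₁ i)) → ∃ c : ℂ, C' = c • C₁)
    (hU₂ : ∀ C' : Poly3, C' ≠ 0 → C'.IsHomogeneous 2 →
      (∀ i, VanishesAt C' (r₂ i)) → ∃ c : ℂ, C' = c • C₂)
    (hU₃ : ∀ C' : Poly3, C' ≠ 0 → C'.IsHomogeneous 2 →
      (∀ i, VanishesAt C' (r₃ i)) → ∃ c : ℂ, C' = c • C₃) :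
    ∃ a b c : ℂ, ¬(a = 0 ∧ b = 0 ∧ c = 0) ∧ a • C₁ + b • C₂ + c • C₃ = 0 := by
  set P : Fin 8 → ProjPlane := ![A, B, C, D, E, F, G, H] with hPdef
  have hP : Function.Injective P := List.nodup_ofFn.1 (by simpa [hPdef] using hdist)
  have hmem : ∀ i, P i ∈ [A, B, C, D, E, F, G, H] := by
    intro i
    fin_cases i <;> simp [hPdef]
  have hrange : Set.range P = {A, B, C, D, E, F, G, H} := by
    ext p
    simp only [hPdef, Matrix.range_cons, Matrix.range_empty, Set.union_empty, Set.mem_union,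
      Set.mem_singleton_iff, Set.mem_insert_iff]
  rw [← hrange] at hz₁ hz₂ hz₃
  simp only [← hrange] at hd₁ hd₂ hd₃
  obtain ⟨c, hc⟩ := exists_linear_functional_on_quartics hKh hKirr hP fun i => honK _ (hmem i)
  obtain ⟨-, h1, hp1⟩ := hQ Q₁ (by simp)
  obtain ⟨-, h2, hp2⟩ := hQ Q₂ (by simp)
  obtain ⟨-, h3, hp3⟩ := hQ Q₃ (by simp)
  have hv₁ : ∀ i, r₁ i ∈ zeroSet Q₂ ∩ zeroSet Q₃ := fun i => hz₁ ▸ Or.inr ⟨i, rfl⟩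
  have hv₂ : ∀ i, r₂ i ∈ zeroSet Q₁ ∩ zeroSet Q₃ := fun i => hz₂ ▸ Or.inr ⟨i, rfl⟩
  have hv₃ : ∀ i, r₃ i ∈ zeroSet Q₁ ∩ zeroSet Q₂ := fun i => hz₃ ▸ Or.inr ⟨i, rfl⟩
  obtain ⟨hne, t₁, ht₁, e₁⟩ := exists_combination_eq_mul_mystic_conic hKh hKirr hc h2 h3
    (fun i => hp2 _ (hmem i)) (fun i => hp3 _ (hmem i)) hrel₁ hd₁
    (fun i => (hv₁ i).1) (fun i => (hv₁ i).2) hU₁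
  obtain ⟨-, t₂, ht₂, e₂⟩ := exists_combination_eq_mul_mystic_conic hKh hKirr hc h1 h3
    (fun i => hp1 _ (hmem i)) (fun i => hp3 _ (hmem i)) hrel₂ hd₂
    (fun i => (hv₂ i).1) (fun i => (hv₂ i).2) hU₂
  obtain ⟨-, t₃, ht₃, e₃⟩ := exists_combination_eq_mul_mystic_conic hKh hKirr hc h1 h2
    (fun i => hp1 _ (hmem i)) (fun i => hp2 _ (hmem i)) hrel₃ hd₃
    (fun i => (hv₃ i).1) (fun i => (hv₃ i).2) hU₃
  refine ⟨c Q₁ * t₁, -(c Q₂ * t₂), c Q₃ * t₃, ?_, ?_⟩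
  · rintro ⟨-, hb, hc'⟩
    simp only [neg_eq_zero, mul_eq_zero, ht₂, ht₃, or_false] at hb hc'
    exact hne.elim (fun h => h hb) fun h => h hc'
  · refine (mul_eq_zero.1 ?_).resolve_left hKirr.ne_zero
    simp only [smul_eq_C_mul, map_mul, map_neg] at e₁ e₂ e₃ ⊢
    linear_combination -MvPolynomial.C (c Q₁) * e₁ + MvPolynomial.C (c Q₂) * e₂
      - MvPolynomial.C (c Q₃) * e₃
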